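/- Fix z ∈ ℤ and λ ∈ ℝ. For any sequence (y₁(k), y₂(k)) in ℤ² with |y₂(k)| → ∞ and y₁(k)/y₂(k)² → λ, the sequence |y₂(k)| · ∫_{−π}^{π} e^{i t (y₁(k) − z)} · ψ(t)^{|y₂(k)|}/(1 − φ(t)) dt converges to a nonzero (complex) constant. -/

import Mathlib

open Filter Real Complex

noncomputable section

/-- `w(t) = 3 - 2 exp(it)`. -/
def wFn (t : ℝ) : ℂ := 3 - 2 * Complex.exp (Complex.I * t)

/-- `ψ(t) = w(t) - √(w(t)²-1)` (principal branch of the complex square root). -/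
def psiFn (t : ℝ) : ℂ := wFn t - (wFn t ^ 2 - 1) ^ ((1 : ℂ) / 2)

/-- `φ(t) = Re(w(t)·ψ(t))`. -/
def phiFn (t : ℝ) : ℝ := (wFn t * psiFn t).re

open MeasureTheory in
theorem rot_lemma (f : ℂ → ℂ) (hf : Differentiable ℂ f) (d : ℂ)
    (h1 : IntegrableOn (fun v : ℝ => f v) (Set.Ioi 0))
    (h2 : IntegrableOn (fun v : ℝ => f (d * v)) (Set.Ioi 0))
    (c : ℝ) (hc : 0 < c)
    (hb : ∀ V : ℝ, 1 ≤ V → ∀ s : ℝ, 0 ≤ s → s ≤ 1 →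
      ‖f (V * (1 + s * (d - 1)))‖ ≤ Real.exp (-c * V)) :
    ∫ v in Set.Ioi (0:ℝ), f v = d * ∫ v in Set.Ioi (0:ℝ), f (d * v) := by
  obtain ⟨g, hg⟩ := hf.isExactOn_univ
  have hg' : ∀ z, HasDerivAt g (f z) z := fun z => hg z (Set.mem_univ _)
  have fc : Continuous f := hf.continuous
  have e1 : ∀ V : ℝ, ∫ v in (0:ℝ)..V, f v = g V - g 0 := by
    intro V
    have := intervalIntegral.integral_eq_sub_of_hasDerivAt (a := 0) (b := V)
      (f := fun v : ℝ => g v) (f' := fun v : ℝ => f v)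
      (fun x _ => (hg' x).comp_ofReal) (by
        apply Continuous.intervalIntegrable; fun_prop)
    simpa using this
  have e2 : ∀ V : ℝ, ∫ v in (0:ℝ)..V, d * f (d * v) = g (d * V) - g 0 := by
    intro V
    have := intervalIntegral.integral_eq_sub_of_hasDerivAt (a := 0) (b := V)
      (f := fun v : ℝ => g (d * v)) (f' := fun v : ℝ => d * f (d * v))
      (fun x _ => by
        have h3 : HasDerivAt (fun z : ℂ => d * z) d (x : ℂ) := by
          simpa using (hasDerivAt_id (x:ℂ)).const_mul d
        have h4 := (hg' (d * x)).comp (x : ℂ) h3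
        have h5 := h4.comp_ofReal
        rw [mul_comm] at h5
        exact h5) (by
        apply Continuous.intervalIntegrable; fun_prop)
    simpa using this
  have t1 := intervalIntegral_tendsto_integral_Ioi 0 h1 tendsto_id
  have t2 := intervalIntegral_tendsto_integral_Ioi 0 (h2.const_mul d) tendsto_id
  rw [integral_const_mul] at t2
  simp only [id, e1, e2] at t1 t2
  have t3 := t1.sub t2
  have t4 : Tendsto (fun V : ℝ => (g V - g 0) - (g (d * V) - g 0)) atTop (nhds 0) := by
    apply squeeze_zero_norm' (a := fun V : ℝ => ‖1 - d‖ * (V ^ (1:ℝ) * Real.exp (-c * V)))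
    · filter_upwards [eventually_ge_atTop 1] with V hV
      have hV0 : 0 ≤ V := by linarith
      have := Convex.norm_image_sub_le_of_norm_hasDerivWithin_le (f := g) (f' := f)
        (s := segment ℝ (V:ℂ) (d * V)) (x := d * V) (y := V) (C := Real.exp (-c * V))
        (fun x _ => (hg' x).hasDerivWithinAt) (by
          intro x hx
          rw [segment_eq_image] at hx
          obtain ⟨s, hs, rfl⟩ := hx
          have := hb V hV s hs.1 hs.2
          have e : (fun θ : ℝ => (1 - θ) • (V:ℂ) + θ • (d * V)) s = V * (1 + s * (d - 1)) := by
            simp only [Complex.real_smul]; push_cast; ring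
          rw [e]
          exact this) (convex_segment _ _)
          (right_mem_segment _ _ _) (left_mem_segment _ _ _)
      rw [sub_sub_sub_cancel_right]
      refine this.trans (le_of_eq ?_)
      rw [show (V:ℂ) - d * V = (1 - d) * V by ring, norm_mul, Complex.norm_real,
        Real.norm_of_nonneg hV0, Real.rpow_one]
      ring
    · have := (tendsto_rpow_mul_exp_neg_mul_atTop_nhds_zero 1 c hc)
      simpa using this.const_mul ‖1 - d‖
  have := tendsto_nhds_unique t3 t4
  exact sub_eq_zero.1 this

theorem norm_f_eq (lam : ℝ) (x y : ℝ) :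
    ‖Complex.exp (Complex.I * (lam / 2) * ((x:ℂ) + y * I) ^ 2 - (1 - Complex.I) * ((x:ℂ) + y * I))‖
      = Real.exp (- lam * x * y - (x + y)) := by
  rw [Complex.norm_exp]
  congr 1
  simp [pow_two]
  ring

open MeasureTheory in
theorem int_L (lam : ℝ) : IntegrableOn (fun v : ℝ =>
    Complex.exp (Complex.I * (lam / 2) * (v:ℂ) ^ 2 - (1 - Complex.I) * v)) (Set.Ioi 0) := by
  have := exp_neg_integrableOn_Ioi 0 (b := 1) one_pos
  refine Integrable.mono' this (by
    apply Continuous.aestronglyMeasurable; fun_prop) (Eventually.of_forall fun v => ?_)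
  have := norm_f_eq lam v 0
  simp only [ofReal_zero, zero_mul, add_zero] at this
  rw [this]; simp

open MeasureTheory in
theorem re_L_pos_of_nonneg (lam : ℝ) (hl : 0 ≤ lam) : 0 < (∫ v in Set.Ioi (0:ℝ),
    Complex.exp (Complex.I * (lam / 2) * (v:ℂ) ^ 2 - (1 - Complex.I) * v)).re := by
  set f : ℂ → ℂ := fun v => Complex.exp (Complex.I * (lam / 2) * v ^ 2 - (1 - Complex.I) * v) with hf
  have key : ∀ v : ℝ, f ((1 + I) * v) = ((Real.exp (-lam * v ^ 2 - 2 * v) : ℝ) : ℂ) := by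
    intro v
    simp only [hf]
    push_cast
    congr 1
    linear_combination ((v:ℂ) + lam * v ^ 2 + lam / 2 * v^2 * I) * Complex.I_sq
  have hint : IntegrableOn (fun v : ℝ => Real.exp (-lam * v ^ 2 - 2 * v)) (Set.Ioi 0) := by
    have := exp_neg_integrableOn_Ioi 0 (b := 2) two_pos
    refine Integrable.mono' this (by
      apply Continuous.aestronglyMeasurable; fun_prop) (Eventually.of_forall fun v => ?_)
    rw [Real.norm_of_nonneg (Real.exp_pos _).le]
    apply Real.exp_le_exp.2
    nlinarith [mul_nonneg hl (sq_nonneg v)]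
  have := rot_lemma f (by simp only [hf]; fun_prop) (1 + I) (int_L lam) (by
      simp only [key]; exact hint.ofReal) 1 one_pos (by
      intro V hV s hs0 hs1
      have := norm_f_eq lam V (V * s)
      rw [show (V:ℂ) * (1 + s * (1 + I - 1)) = (V:ℂ) + ((V * s : ℝ) : ℂ) * I by push_cast; ring]
      refine this.le.trans (Real.exp_le_exp.2 ?_)
      have : 0 ≤ lam * V * (V * s) := by positivity
      have : 0 ≤ V * s := by positivity
      linarith)
  rw [show (∫ v in Set.Ioi (0:ℝ),
    Complex.exp (Complex.I * (lam / 2) * (v:ℂ) ^ 2 - (1 - Complex.I) * v)) =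
      ∫ v in Set.Ioi (0:ℝ), f v from rfl, this]
  simp only [key]
  rw [integral_complex_ofReal, Complex.re_mul_ofReal]
  simp only [add_re, one_re, I_re, add_zero, one_mul]
  rw [integral_pos_iff_support_of_nonneg (fun v => (Real.exp_pos _).le) hint]
  have : Function.support (fun v : ℝ => Real.exp (-lam * v ^ 2 - 2 * v)) = Set.univ := by
    ext v; simp [(Real.exp_pos _).ne']
  rw [this]; simp

open MeasureTheory in
theorem cos_gauss_pos (mu : ℝ) (hm : 0 < mu) :
    0 < ∫ v in Set.Ioi (0:ℝ), Real.exp (-mu * v ^ 2) * Real.cos (2 * v) := by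
  have h := integral_comp_abs (f := fun v : ℝ => Real.exp (-mu * v ^ 2) * Real.cos (2 * v))
  have h2 := fourierIntegral_gaussian (b := mu) (by simpa using hm) 2
  have e : ∀ v : ℝ, Real.exp (-mu * |v| ^ 2) * Real.cos (2 * |v|) =
      (Complex.exp (I * 2 * v) * Complex.exp (-mu * v ^ 2)).re := by
    intro v
    rw [show Complex.exp (-mu * v ^ 2) = ((Real.exp (-mu * v ^ 2) : ℝ) : ℂ) by push_cast; rfl,
      Complex.re_mul_ofReal, show I * 2 * (v:ℂ) = ((2 * v : ℝ) : ℂ) * I by push_cast; ring,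
      Complex.exp_ofReal_mul_I_re, sq_abs, show 2 * |v| = |2 * v| by simp [abs_mul], Real.cos_abs]
    ring
  have hi : Integrable (fun v : ℝ => Complex.exp (I * 2 * v) * Complex.exp (-mu * v ^ 2)) := by
    refine (integrable_exp_neg_mul_sq hm).mono' (by
      apply Continuous.aestronglyMeasurable; fun_prop) (Eventually.of_forall fun v => ?_)
    rw [norm_mul, Complex.norm_exp, Complex.norm_exp]
    simp [← ofReal_pow]
  have h3 : ∫ v : ℝ, Real.exp (-mu * |v| ^ 2) * Real.cos (2 * |v|) =
      √(π / mu) * Real.exp (- 1 / mu) := by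
    simp only [e]
    have h5 : ∫ v : ℝ, (Complex.exp (I * 2 * v) * Complex.exp (-mu * v ^ 2)).re =
      (∫ v : ℝ, (Complex.exp (I * 2 * v) * Complex.exp (-mu * v ^ 2))).re := integral_re hi
    rw [h5, h2]
    rw [Real.sqrt_eq_rpow, ← Complex.ofReal_re (_ * _)]
    congr 1
    push_cast [Complex.ofReal_cpow (show 0 ≤ π / mu by positivity)]
    congr 2
    ring
  rw [h3] at h
  have : 0 < √(π / mu) * Real.exp (- 1 / mu) := by positivity
  linarith

open MeasureTheory in
theorem sin_gauss_nonneg (mu : ℝ) (hm : 0 < mu) :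
    0 ≤ ∫ v in Set.Ioi (0:ℝ), Real.exp (-mu * v ^ 2) * Real.sin (2 * v) := by
  have i1 : IntegrableOn (fun v : ℝ => Real.exp (-mu * v ^ 2) * Real.sin (2 * v)) (Set.Ioi 0) := by
    refine (integrable_exp_neg_mul_sq hm).integrableOn.mono' (by
      apply Continuous.aestronglyMeasurable; fun_prop) (Eventually.of_forall fun v => ?_)
    rw [norm_mul, Real.norm_of_nonneg (Real.exp_pos _).le]
    exact mul_le_of_le_one_right (Real.exp_pos _).le (Real.abs_sin_le_one _)
  have i2 : IntegrableOn (fun v : ℝ => 2 * mu * (v * Real.exp (-mu * v ^ 2)) * Real.sin v ^ 2)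
      (Set.Ioi 0) := by
    refine ((integrable_mul_exp_neg_mul_sq hm).integrableOn.norm.const_mul (2 * mu)).mono' (by
      apply Continuous.aestronglyMeasurable; fun_prop) (Eventually.of_forall fun v => ?_)
    rw [norm_mul, norm_mul, Real.norm_of_nonneg (show 0 ≤ 2 * mu by positivity)]
    apply mul_le_of_le_one_right (by positivity)
    rw [Real.norm_of_nonneg (sq_nonneg _)]
    exact Real.sin_sq_le_one v
  have key := integral_Ioi_of_hasDerivAt_of_tendsto' (a := 0) (m := 0)
    (f := fun v : ℝ => Real.exp (-mu * v ^ 2) * Real.sin v ^ 2)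
    (f' := fun v : ℝ => Real.exp (-mu * v ^ 2) * Real.sin (2 * v) -
      2 * mu * (v * Real.exp (-mu * v ^ 2)) * Real.sin v ^ 2) (by
      intro x _
      have a1 : HasDerivAt (fun v : ℝ => -mu * v ^ 2) (-mu * (2 * x)) x := by
        simpa using (hasDerivAt_pow 2 x).const_mul (-mu)
      have a2 : HasDerivAt (fun v : ℝ => Real.sin v ^ 2) (2 * Real.sin x * Real.cos x) x := by
        simpa using (Real.hasDerivAt_sin x).fun_pow 2
      refine (a1.exp.mul a2).congr_deriv ?_
      rw [Real.sin_two_mul]; ring) (i1.sub i2) (by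
      apply squeeze_zero' (g := fun v : ℝ => Real.exp (-mu * v ^ 2))
      · exact Eventually.of_forall fun v => by positivity
      · exact Eventually.of_forall fun v =>
          mul_le_of_le_one_right (Real.exp_pos _).le (Real.sin_sq_le_one v)
      · apply Real.tendsto_exp_atBot.comp
        exact (tendsto_pow_atTop two_ne_zero).const_mul_atTop_of_neg (by linarith))
  rw [integral_sub i1 i2] at key
  simp only [Real.sin_zero] at key
  have : 0 ≤ ∫ v in Set.Ioi (0:ℝ), 2 * mu * (v * Real.exp (-mu * v ^ 2)) * Real.sin v ^ 2 := by
    apply setIntegral_nonneg measurableSet_Ioi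
    intro v hv
    have : 0 < v := hv
    positivity
  have e0 : Real.exp (-mu * 0 ^ 2) * (0:ℝ) ^ 2 = 0 := by simp
  rw [e0] at key
  linarith

open MeasureTheory in
theorem re_L_pos_of_neg (lam : ℝ) (hl : lam < 0) : 0 < (∫ v in Set.Ioi (0:ℝ),
    Complex.exp (Complex.I * (lam / 2) * (v:ℂ) ^ 2 - (1 - Complex.I) * v)).re := by
  obtain ⟨mu, rfl⟩ : ∃ mu, lam = -mu := ⟨-lam, by ring⟩
  have hm : 0 < mu := by linarith
  set f : ℂ → ℂ := fun v => Complex.exp (Complex.I * ((-mu : ℝ) / 2) * v ^ 2 - (1 - Complex.I) * v) with hf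
  have key : ∀ v : ℝ, f ((1 - I) * v) = ((Real.exp (-mu * v ^ 2) : ℝ) : ℂ) * Complex.exp ((2 * v : ℝ) * I) := by
    intro v
    simp only [hf]
    push_cast
    rw [← Complex.exp_add]
    congr 1
    linear_combination (-(v:ℂ) + mu * v ^ 2 - mu / 2 * v^2 * I) * Complex.I_sq
  have nkey : ∀ v : ℝ, ‖f ((1 - I) * v)‖ = Real.exp (-mu * v ^ 2) := by
    intro v
    rw [key, norm_mul, Complex.norm_exp_ofReal_mul_I, Complex.norm_real,
      Real.norm_of_nonneg (Real.exp_pos _).le, mul_one]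
  have hfd : Differentiable ℂ f := by simp only [hf]; fun_prop
  have hint : IntegrableOn (fun v : ℝ => f ((1 - I) * v)) (Set.Ioi 0) := by
    have := hfd.continuous
    refine (integrable_exp_neg_mul_sq hm).integrableOn.mono' (by
      apply Continuous.aestronglyMeasurable; fun_prop) (Eventually.of_forall fun v => (nkey v).le)
  have := rot_lemma f hfd (1 - I) (int_L (-mu)) hint (min mu 1) (by positivity) (by
      intro V hV s hs0 hs1
      have := norm_f_eq (-mu) V (-(V * s))
      rw [show (V:ℂ) * (1 + s * (1 - I - 1)) = (V:ℂ) + ((-(V * s) : ℝ) : ℂ) * I by push_cast; ring]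
      refine this.le.trans (Real.exp_le_exp.2 ?_)
      have h1 : min mu 1 * (V * s) ≤ mu * (V * s) * V := by
        have : min mu 1 * (V * s) ≤ mu * (V * s) := by
          gcongr; exact min_le_left _ _
        have : mu * (V * s) ≤ mu * (V * s) * V := le_mul_of_one_le_right (by positivity) hV
        linarith
      have h2 : min mu 1 * (V * (1 - s)) ≤ 1 * (V * (1 - s)) := by
        have : 0 ≤ 1 - s := by linarith
        gcongr; exact min_le_right _ _
      linarith)
  rw [show (∫ v in Set.Ioi (0:ℝ),
    Complex.exp (Complex.I * ((-mu : ℝ) / 2) * (v:ℂ) ^ 2 - (1 - Complex.I) * v)) =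
      ∫ v in Set.Ioi (0:ℝ), f v from rfl, this]
  have hre : (∫ v in Set.Ioi (0:ℝ), f ((1 - I) * v)).re =
      ∫ v in Set.Ioi (0:ℝ), Real.exp (-mu * v ^ 2) * Real.cos (2 * v) := by
    have h5 : ∫ v in Set.Ioi (0:ℝ), (f ((1 - I) * v)).re =
      (∫ v in Set.Ioi (0:ℝ), f ((1 - I) * v)).re := integral_re hint
    rw [← h5]
    simp only [key, Complex.re_ofReal_mul, Complex.exp_ofReal_mul_I_re]
  have him : (∫ v in Set.Ioi (0:ℝ), f ((1 - I) * v)).im =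
      ∫ v in Set.Ioi (0:ℝ), Real.exp (-mu * v ^ 2) * Real.sin (2 * v) := by
    have h5 : ∫ v in Set.Ioi (0:ℝ), (f ((1 - I) * v)).im =
      (∫ v in Set.Ioi (0:ℝ), f ((1 - I) * v)).im := integral_im hint
    rw [← h5]
    simp only [key, Complex.im_ofReal_mul, Complex.exp_ofReal_mul_I_im]
  rw [Complex.mul_re, hre, him]
  have := cos_gauss_pos mu hm
  have := sin_gauss_nonneg mu hm
  simp only [Complex.sub_re, Complex.sub_im, Complex.one_re, Complex.one_im, Complex.I_re, Complex.I_im]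
  linarith

theorem re_L_pos (lam : ℝ) : 0 < (∫ v in Set.Ioi (0:ℝ),
    Complex.exp (Complex.I * (lam / 2) * (v:ℂ) ^ 2 - (1 - Complex.I) * v)).re := by
  rcases le_or_gt 0 lam with h | h
  · exact re_L_pos_of_nonneg lam h
  · exact re_L_pos_of_neg lam h

theorem wFn_re (t : ℝ) : (wFn t).re = 3 - 2 * Real.cos t := by
  rw [wFn, mul_comm I]
  simp [Complex.exp_ofReal_mul_I_re]

theorem wFn_im (t : ℝ) : (wFn t).im = - 2 * Real.sin t := by
  rw [wFn, mul_comm I]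
  simp [Complex.exp_ofReal_mul_I_im]

/-- the square root -/
def sFn (t : ℝ) : ℂ := (wFn t ^ 2 - 1) ^ ((1 : ℂ) / 2)

theorem psiFn_eq (t : ℝ) : psiFn t = wFn t - sFn t := rfl

theorem sFn_sq (t : ℝ) : sFn t ^ 2 = wFn t ^ 2 - 1 := by
  rw [sFn, one_div]
  exact Complex.cpow_ofNat_inv_pow _ 2

theorem psi_mul (t : ℝ) : psiFn t * (wFn t + sFn t) = 1 := by
  rw [psiFn_eq]; linear_combination - sFn_sq t

theorem phi_eq (t : ℝ) : phiFn t = (1 + (psiFn t ^ 2).re) / 2 := by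
  have : wFn t * psiFn t = (1 + psiFn t ^ 2) / 2 := by
    rw [psiFn_eq]; linear_combination - sFn_sq t / 2
  rw [phiFn, this]
  simp

theorem sFn_re_nonneg (t : ℝ) : 0 ≤ (sFn t).re := by
  rw [sFn, one_div, Complex.cpow_inv_two_re]; positivity

theorem sFn_re_sq (t : ℝ) : (sFn t).re ^ 2 = (‖wFn t ^ 2 - 1‖ + (wFn t ^ 2 - 1).re) / 2 := by
  rw [sFn, one_div, Complex.cpow_inv_two_re, Real.sq_sqrt]
  have := Complex.abs_re_le_norm (wFn t ^ 2 - 1)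
  have := neg_abs_le (wFn t ^ 2 - 1).re
  linarith

theorem z_re (t : ℝ) : (wFn t ^ 2 - 1).re = 4 * (1 - Real.cos t) * (1 - 2 * Real.cos t) := by
  have := Real.sin_sq_add_cos_sq t
  simp only [pow_two, Complex.sub_re, Complex.mul_re, Complex.one_re, wFn_re, wFn_im]
  linear_combination -4 * this

theorem z_im (t : ℝ) : (wFn t ^ 2 - 1).im = -4 * Real.sin t * (3 - 2 * Real.cos t) := by
  simp only [pow_two, Complex.sub_im, Complex.mul_im, Complex.one_im, wFn_re, wFn_im]
  ring

theorem z_normSq (t : ℝ) : ‖wFn t ^ 2 - 1‖ ^ 2 = 32 * (1 - Real.cos t) * (5 - 4 * Real.cos t) := by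
  have := Real.sin_sq_add_cos_sq t
  rw [← Complex.normSq_eq_norm_sq, Complex.normSq_apply, z_re, z_im]
  linear_combination 16 * (3 - 2 * Real.cos t)^2 * this

theorem sFn_re_ge (x : ℝ) (hx : 0 ≤ x) (hx' : x ^ 2 / 2 ≤ π) : x / 2 ≤ (sFn (x ^ 2 / 2)).re := by
  set t := x ^ 2 / 2 with ht
  have ht0 : 0 ≤ t := by positivity
  set c := Real.cos t
  have hc : c ≤ 1 := Real.cos_le_one t
  have hc' : -1 ≤ c := Real.neg_one_le_cos t
  set r := √(1 - c) with hr
  have hr0 : 0 ≤ r := Real.sqrt_nonneg _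
  have hr2 : r ^ 2 = 1 - c := Real.sq_sqrt (by linarith)
  have h1 : t / 4 ≤ r := by
    have h2 := Real.mul_le_sin (x := t / 2) (by positivity) (by linarith)
    have h3 : t / 4 ≤ Real.sin (t / 2) := by
      refine le_trans ?_ h2
      have : 2 / π * (t / 2) = t / π := by ring
      rw [this]
      exact div_le_div_of_nonneg_left ht0 Real.pi_pos Real.pi_le_four
    have h4 : Real.sin (t/2) ^ 2 * 2 = 1 - c := by
      have := Real.cos_sq_add_sin_sq (t / 2)
      have h5 := Real.cos_two_mul (t / 2)
      rw [show 2 * (t / 2) = t by ring] at h5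
      simp only [c]
      linarith
    apply Real.le_sqrt_of_sq_le
    nlinarith
  have hn : 4 * r * (1 + r) ≤ ‖wFn t ^ 2 - 1‖ := by
    apply le_of_sq_le_sq ?_ (norm_nonneg _)
    rw [z_normSq]
    have : 32 * (1 - c) * (5 - 4 * c) = 32 * r ^ 2 * (1 + 4 * r ^ 2) := by rw [hr2]; ring
    rw [this]
    have : 0 ≤ r ^ 2 * (1 - r) ^ 2 := by positivity
    have : 0 ≤ r ^ 2 * r ^ 2 := by positivity
    nlinarith
  have h6 := sFn_re_sq t
  rw [z_re] at h6
  have h7 : 4 * (1 - c) * (1 - 2 * c) = 4 * r ^ 2 * (2 * r ^ 2 - 1) := by rw [hr2]; ring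
  have h8 : (x / 2) ^ 2 ≤ (sFn t).re ^ 2 := by
    rw [h6, h7]
    have : (x / 2) ^ 2 = t / 2 := by rw [ht]; ring
    rw [this]
    have : 0 ≤ r ^ 2 * r ^ 2 := by positivity
    nlinarith
  exact le_of_sq_le_sq h8 (sFn_re_nonneg t)

theorem psi_norm_le (x : ℝ) (hx : 0 ≤ x) (hx' : x ^ 2 / 2 ≤ π) :
    ‖psiFn (x ^ 2 / 2)‖ ≤ 1 - x / 5 := by
  have h1 := sFn_re_ge x hx hx'
  have hx3 : x ≤ 3 := by
    have := Real.pi_le_four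
    nlinarith
  set t := x ^ 2 / 2
  have h2 : 1 + x / 2 ≤ ‖wFn t + sFn t‖ := by
    refine le_trans ?_ (Complex.re_le_norm _)
    rw [Complex.add_re, wFn_re]
    have := Real.cos_le_one t
    linarith
  have h3 : ‖psiFn t‖ * ‖wFn t + sFn t‖ = 1 := by rw [← norm_mul, psi_mul, norm_one]
  have h4 : ‖psiFn t‖ * (1 + x / 2) ≤ 1 := by
    exact (mul_le_mul_of_nonneg_left h2 (norm_nonneg _)).trans h3.le
  have h5 : ‖psiFn t‖ ≤ 1 / (1 + x / 2) := by
    rw [le_div_iff₀ (by positivity)]; exact h4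
  refine h5.trans ?_
  rw [div_le_iff₀ (by positivity)]
  nlinarith

theorem phi_le (x : ℝ) (hx : 0 ≤ x) (hx' : x ^ 2 / 2 ≤ π) :
    x / 10 ≤ 1 - phiFn (x ^ 2 / 2) := by
  have h := psi_norm_le x hx hx'
  rw [phi_eq]
  set q := psiFn (x ^ 2 / 2)
  have h1 : (q ^ 2).re ≤ ‖q‖ ^ 2 := by
    rw [← norm_pow]; exact Complex.re_le_norm _
  have h2 : 0 ≤ ‖q‖ := norm_nonneg _
  nlinarith

theorem z_mem_slit (t : ℝ) (h0 : 0 < t) (h1 : t < π) : wFn t ^ 2 - 1 ∈ Complex.slitPlane := by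
  right
  rw [z_im]
  have := Real.sin_pos_of_pos_of_lt_pi h0 h1
  have := Real.cos_le_one t
  have : 0 < 3 - 2 * Real.cos t := by linarith
  have : 0 < 4 * Real.sin t * (3 - 2 * Real.cos t) := by positivity
  linarith

theorem wFn_neg (t : ℝ) : wFn (-t) = (starRingEnd ℂ) (wFn t) := by
  apply Complex.ext <;> simp [wFn_re, wFn_im]

theorem psiFn_neg (t : ℝ) (h0 : 0 < t) (h1 : t < π) : psiFn (-t) = (starRingEnd ℂ) (psiFn t) := by
  have h := Complex.slitPlane_arg_ne_pi (z_mem_slit t h0 h1)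
  have h2 := Complex.conj_cpow _ ((1:ℂ)/2) h
  rw [psiFn, wFn_neg, psiFn, map_sub, ← map_pow, ← map_one (starRingEnd ℂ), ← map_sub, map_one, h2]
  have : (starRingEnd ℂ) ((1:ℂ)/2) = 1 / 2 := by
    rw [map_div₀, map_one, Complex.conj_ofNat]
  rw [this]

theorem phiFn_neg (t : ℝ) (h0 : 0 < t) (h1 : t < π) : phiFn (-t) = phiFn t := by
  rw [phiFn, psiFn_neg t h0 h1, wFn_neg, ← map_mul, Complex.conj_re, phiFn]

theorem sqrt_scale (x : ℝ) (hx : 0 < x) (a : ℂ) (ha : a ≠ 0) :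
    ((x ^ 2 : ℝ) * a) ^ ((1:ℂ)/2) = x * a ^ ((1:ℂ)/2) := by
  have hx2 : (0:ℝ) < x ^ 2 := by positivity
  rw [Complex.cpow_def_of_ne_zero, Complex.cpow_def_of_ne_zero ha, Complex.log_ofReal_mul hx2 ha,
    Real.log_pow]
  · have : (x:ℂ) = Complex.exp (Real.log x) := by
      rw [← Complex.ofReal_exp, Real.exp_log hx]
    conv_rhs => rw [this]
    rw [← Complex.exp_add]
    congr 1
    push_cast
    ring
  · simp [ha, hx.ne']

theorem sqrt_neg_two_I : (-2 * I) ^ ((1:ℂ)/2) = 1 - I := by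
  have h : (-2 * I : ℂ) = (1 - I) ^ 2 := by linear_combination -Complex.I_sq
  rw [h, one_div]
  apply Complex.sq_cpow_two_inv
  simp

/-- `(e^{it}-1)/t → i` with `t = x²/2`. -/
theorem exp_lim : Tendsto (fun x : ℝ => (Complex.exp (I * ((x ^ 2 / 2 : ℝ) : ℂ)) - 1) / ((x ^ 2 / 2 : ℝ) : ℂ))
    (nhdsWithin 0 (Set.Ioi 0)) (nhds I) := by
  have h : HasDerivAt (fun t : ℝ => Complex.exp (I * (t:ℂ))) I 0 := by
    have h1 : HasDerivAt (fun z : ℂ => I * z) I ((0:ℝ):ℂ) := by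
      simpa using (hasDerivAt_id ((0:ℝ):ℂ)).const_mul I
    simpa using h1.cexp.comp_ofReal
  have h2 := h.tendsto_slope_zero_right
  have h3 : Tendsto (fun x : ℝ => x ^ 2 / 2) (nhdsWithin 0 (Set.Ioi 0)) (nhdsWithin 0 (Set.Ioi 0)) := by
    apply tendsto_nhdsWithin_of_tendsto_nhds_of_eventually_within
    · have : Continuous (fun x : ℝ => x ^ 2 / 2) := by fun_prop
      simpa using (this.tendsto 0).mono_left nhdsWithin_le_nhds
    · filter_upwards [self_mem_nhdsWithin] with x hx
      have : 0 < x := hx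
      show 0 < x ^ 2 / 2
      positivity
  refine (h2.comp h3).congr fun x => ?_
  simp [div_eq_inv_mul]

theorem psi_lim : Tendsto (fun x : ℝ => (psiFn (x ^ 2 / 2) - 1) / x)
    (nhdsWithin 0 (Set.Ioi 0)) (nhds (-(1 - I))) := by
  have hE := exp_lim
  set E : ℝ → ℂ := fun x => (Complex.exp (I * ((x ^ 2 / 2 : ℝ) : ℂ)) - 1) / ((x ^ 2 / 2 : ℝ) : ℂ) with hEd
  have hx : Tendsto (fun x : ℝ => (x:ℂ)) (nhdsWithin 0 (Set.Ioi 0)) (nhds 0) := by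
    simpa using (Complex.continuous_ofReal.tendsto 0).mono_left nhdsWithin_le_nhds
  have hw : ∀ x : ℝ, 0 < x → wFn (x ^ 2 / 2) = 1 - x ^ 2 * E x := by
    intro x hx
    have : (x:ℂ) ≠ 0 := by exact_mod_cast hx.ne'
    simp only [hEd, wFn]
    push_cast
    field_simp
    ring
  set a : ℝ → ℂ := fun x => -2 * E x + x ^ 2 * E x ^ 2 with ha
  have hz : ∀ x : ℝ, 0 < x → wFn (x ^ 2 / 2) ^ 2 - 1 = (x ^ 2 : ℝ) * a x := by
    intro x hx
    rw [hw x hx, ha]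
    push_cast
    ring
  have hal : Tendsto a (nhdsWithin 0 (Set.Ioi 0)) (nhds (-2 * I)) := by
    have := (hE.const_mul (-2)).add ((hx.pow 2).mul (hE.pow 2))
    rw [ha]
    simpa using this
  have hsl : (-2 * I : ℂ) ∈ Complex.slitPlane := by right; simp
  have hsq : Tendsto (fun x => a x ^ ((1:ℂ)/2)) (nhdsWithin 0 (Set.Ioi 0)) (nhds (1 - I)) := by
    rw [← sqrt_neg_two_I]
    exact hal.cpow tendsto_const_nhds hsl
  have hne : ∀ᶠ x in nhdsWithin 0 (Set.Ioi 0), a x ≠ 0 :=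
    hal.eventually_ne (by simp)
  have main : Tendsto (fun x : ℝ => - x * E x - a x ^ ((1:ℂ)/2)) (nhdsWithin 0 (Set.Ioi 0)) (nhds (-(1 - I))) := by
    have := (hx.neg.mul hE).sub hsq
    simpa using this
  refine main.congr' ?_
  filter_upwards [hne, self_mem_nhdsWithin] with x h1 h2
  have hx0 : 0 < x := h2
  have : (x:ℂ) ≠ 0 := by exact_mod_cast hx0.ne'
  rw [psiFn, hz x hx0, sqrt_scale x hx0 _ h1, hw x hx0]
  field_simp
  ring

theorem phi_lim : Tendsto (fun x : ℝ => x / (1 - phiFn (x ^ 2 / 2)))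
    (nhdsWithin 0 (Set.Ioi 0)) (nhds 1) := by
  have h := psi_lim
  have hx : Tendsto (fun x : ℝ => (x:ℂ)) (nhdsWithin 0 (Set.Ioi 0)) (nhds 0) := by
    simpa using (Complex.continuous_ofReal.tendsto 0).mono_left nhdsWithin_le_nhds
  set q : ℝ → ℂ := fun x => (psiFn (x ^ 2 / 2) - 1) / x with hq
  have h1 : Tendsto (fun x : ℝ => - (q x + x * q x ^ 2 / 2).re) (nhdsWithin 0 (Set.Ioi 0)) (nhds 1) := by
    have := (h.add ((hx.mul (h.pow 2)).div_const 2))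
    have := ((Complex.continuous_re.tendsto _).comp this).neg
    simpa using this
  have h2 := h1.inv₀ one_ne_zero
  rw [inv_one] at h2
  refine h2.congr' ?_
  filter_upwards [self_mem_nhdsWithin] with x h2
  have hx0 : 0 < x := h2
  have hxc : (x:ℂ) ≠ 0 := by exact_mod_cast hx0.ne'
  have e : psiFn (x ^ 2 / 2) = 1 + x * q x := by simp only [hq]; field_simp; ring
  rw [phi_eq, e]
  have : ((1 + x * q x) ^ 2).re = 1 + 2 * x * (q x + x * q x ^ 2 / 2).re := by
    have : (1 + x * q x) ^ 2 = 1 + ((2 * x : ℝ) : ℂ) * (q x + x * q x ^ 2 / 2) := by push_cast; ring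
    rw [this, Complex.add_re, Complex.re_ofReal_mul, Complex.one_re]
  rw [this]
  have : 1 - (1 + (1 + 2 * x * (q x + x * q x ^ 2 / 2).re)) / 2 = x * -(q x + x * q x ^ 2 / 2).re := by ring
  rw [this, div_mul_eq_div_div, div_self hx0.ne', one_div]

theorem psi_meas : Measurable psiFn := by
  unfold psiFn wFn
  fun_prop

theorem phi_meas : Measurable phiFn := by
  have := psi_meas
  unfold phiFn
  have : Measurable wFn := by unfold wFn; fun_prop
  fun_prop

/-- the integrand -/
def hFn (m : ℝ) (N : ℕ) (t : ℝ) : ℂ :=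
  Complex.exp (Complex.I * t * m) * psiFn t ^ N / (1 - (phiFn t : ℂ))

theorem hFn_meas (m : ℝ) (N : ℕ) : Measurable (hFn m N) := by
  have := psi_meas
  have := phi_meas
  unfold hFn
  fun_prop

theorem hFn_norm_le (m : ℝ) (N : ℕ) (x : ℝ) (hx : 0 < x) (hx' : x ^ 2 / 2 ≤ π) :
    ‖hFn m N (x ^ 2 / 2)‖ ≤ Real.exp (-(x / 5)) ^ N * (10 / x) := by
  have h1 := psi_norm_le x hx.le hx'
  have h2 := phi_le x hx.le hx'
  have h3 : ‖psiFn (x ^ 2 / 2)‖ ≤ Real.exp (-(x / 5)) := by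
    have := Real.add_one_le_exp (-(x / 5))
    linarith
  have h4 : ‖(1 : ℂ) - (phiFn (x ^ 2 / 2) : ℂ)‖ = 1 - phiFn (x ^ 2 / 2) := by
    rw [← Complex.ofReal_one, ← Complex.ofReal_sub, Complex.norm_real, Real.norm_of_nonneg]
    have : 0 ≤ x / 10 := by positivity
    linarith
  rw [hFn, norm_div, norm_mul, norm_pow, h4, div_eq_mul_inv]
  have h5 : ‖Complex.exp (Complex.I * ((x ^ 2 / 2 : ℝ) : ℂ) * m)‖ = 1 := by
    rw [show Complex.I * ((x ^ 2 / 2 : ℝ) : ℂ) * m = ((x ^ 2 / 2 * m : ℝ) : ℂ) * I by push_cast; ring,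
      Complex.norm_exp_ofReal_mul_I]
  rw [h5, one_mul]
  have h6 : (1 - phiFn (x ^ 2 / 2))⁻¹ ≤ 10 / x := by
    rw [show 10 / x = (x / 10)⁻¹ by rw [inv_div]]
    exact inv_anti₀ (by positivity) h2
  have h7 : 0 ≤ (1 - phiFn (x ^ 2 / 2))⁻¹ := by
    have : 0 ≤ x / 10 := by positivity
    exact inv_nonneg.2 (by linarith)
  gcongr

theorem hFn_neg (m : ℝ) (N : ℕ) (t : ℝ) (h0 : 0 < t) (h1 : t < π) :
    hFn m N (-t) = (starRingEnd ℂ) (hFn m N t) := by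
  rw [hFn, hFn, psiFn_neg t h0 h1, phiFn_neg t h0 h1]
  simp only [map_div₀, map_mul, map_pow, map_sub, map_one, Complex.conj_ofReal, ← Complex.exp_conj,
    Complex.conj_I, Complex.ofReal_neg]
  simp

open MeasureTheory in
theorem hFn_int (m : ℝ) (N : ℕ) : IntervalIntegrable (hFn m N) volume 0 π := by
  have h := (intervalIntegral.intervalIntegrable_rpow' (a := 0) (b := π) (r := -1/2)
    (by norm_num)).const_mul 10
  refine h.mono_fun' (hFn_meas m N).aestronglyMeasurable ?_
  rw [Set.uIoc_of_le Real.pi_pos.le]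
  filter_upwards [ae_restrict_mem measurableSet_Ioc] with t ht
  have ht0 : 0 < t := ht.1
  have hx : 0 < √(2 * t) := by positivity
  have e : √(2 * t) ^ 2 / 2 = t := by rw [Real.sq_sqrt (by positivity)]; ring
  have := hFn_norm_le m N (√(2 * t)) hx (by rw [e]; exact ht.2)
  rw [e] at this
  refine this.trans ?_
  have h1 : Real.exp (-(√(2 * t) / 5)) ^ N ≤ 1 := by
    apply pow_le_one₀ (Real.exp_pos _).le
    apply Real.exp_le_one_iff.2
    have : 0 ≤ √(2 * t) / 5 := by positivity
    linarith
  have h2 : 10 / √(2 * t) ≤ 10 * t ^ (-1 / 2 : ℝ) := by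
    rw [neg_div, Real.rpow_neg ht0.le, ← Real.sqrt_eq_rpow, div_eq_mul_inv]
    gcongr
    linarith
  calc _ ≤ 1 * (10 / √(2 * t)) := by gcongr
    _ ≤ _ := by rw [one_mul]; exact h2

open MeasureTheory in
theorem full_eq (m : ℝ) (N : ℕ) : ∫ t in (-π)..π, hFn m N t =
    (∫ t in (0:ℝ)..π, hFn m N t) + (starRingEnd ℂ) (∫ t in (0:ℝ)..π, hFn m N t) := by
  have hi := hFn_int m N
  have hae : ∀ᵐ t ∂(volume.restrict (Set.Ioc 0 π)), hFn m N (-t) = (starRingEnd ℂ) (hFn m N t) := by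
    rw [← Measure.restrict_congr_set Ioo_ae_eq_Ioc]
    filter_upwards [ae_restrict_mem measurableSet_Ioo] with t ht
    exact hFn_neg m N t ht.1 ht.2
  have hi2 : IntervalIntegrable (fun t => hFn m N (-t)) volume 0 π := by
    refine hi.norm.mono_fun' ((hFn_meas m N).comp measurable_neg).aestronglyMeasurable ?_
    rw [Set.uIoc_of_le Real.pi_pos.le]
    filter_upwards [hae] with t ht
    rw [ht]; simp
  have hi3 : IntervalIntegrable (hFn m N) volume (-π) 0 := by
    rw [IntervalIntegrable.iff_comp_neg]
    simpa using hi2.symm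
  rw [← intervalIntegral.integral_add_adjacent_intervals hi3 hi, add_comm]
  congr 1
  have := intervalIntegral.integral_comp_neg (a := 0) (b := π) (hFn m N)
  rw [neg_zero] at this
  rw [← this, intervalIntegral.integral_of_le Real.pi_pos.le,
    intervalIntegral.integral_of_le Real.pi_pos.le, ← integral_conj]
  exact integral_congr_ae hae

open MeasureTheory in
theorem cov (h : ℝ → ℂ) (N : ℕ) (hN : 1 ≤ N) : (N : ℂ) * ∫ t in (0:ℝ)..π, h t =
    ∫ u in Set.Ioi (0:ℝ), (u / N) • (Set.Iic π).indicator h ((u / N) ^ 2 / 2) := by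
  have hN0 : (0:ℝ) < N := by exact_mod_cast hN
  have hNc : (N:ℂ) ≠ 0 := by exact_mod_cast hN0.ne'
  set H := (Set.Iic π).indicator h with hH
  have h1 : ∫ t in (0:ℝ)..π, h t = ∫ t in Set.Ioi (0:ℝ), H t := by
    rw [intervalIntegral.integral_of_le Real.pi_pos.le, hH, setIntegral_indicator measurableSet_Iic]
    rfl
  have h2 := integral_comp_mul_left_Ioi H 0 (b := (2 * (N:ℝ) ^ 2)⁻¹) (by positivity)
  rw [mul_zero, inv_inv] at h2
  have h3 := integral_comp_rpow_Ioi_of_pos (g := fun t => H ((2 * (N:ℝ) ^ 2)⁻¹ * t)) (p := 2) two_pos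
  rw [h2] at h3
  rw [h1]
  have h4 : ∫ u in Set.Ioi (0:ℝ), (u / N) • H ((u / N) ^ 2 / 2) =
      (2 * (N:ℝ))⁻¹ • ∫ (x : ℝ) in Set.Ioi 0, (2 * x ^ ((2:ℝ) - 1)) • H ((2 * (N:ℝ) ^ 2)⁻¹ * x ^ (2:ℝ)) := by
    rw [← integral_smul]
    congr 1
    ext u
    rw [smul_smul]
    have e1 : (u / N) ^ 2 / 2 = (2 * (N:ℝ) ^ 2)⁻¹ * u ^ (2:ℝ) := by
      rw [Real.rpow_two]; field_simp
    have e2 : u / N = (2 * (N:ℝ))⁻¹ * (2 * u ^ ((2:ℝ) - 1)) := by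
      rw [show (2:ℝ) - 1 = 1 by norm_num, Real.rpow_one]; field_simp
    rw [e1, ← e2]
  rw [h4, h3, smul_smul]
  rw [Complex.real_smul]
  congr 1
  push_cast
  field_simp

open MeasureTheory in
theorem half_lim (lam : ℝ) (m : ℕ → ℝ) (N : ℕ → ℕ) (hN : Tendsto N atTop atTop)
    (hm : Tendsto (fun k => m k / (N k : ℝ) ^ 2) atTop (nhds lam)) :
    Tendsto (fun k => (N k : ℂ) * ∫ t in (0:ℝ)..π, hFn (m k) (N k) t) atTop
      (nhds (∫ v in Set.Ioi (0:ℝ),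
        Complex.exp (Complex.I * (lam / 2) * (v:ℂ) ^ 2 - (1 - Complex.I) * v))) := by
  have hN1 : ∀ᶠ k in atTop, 1 ≤ N k := hN.eventually_ge_atTop 1
  have hcong : (fun k => ∫ u in Set.Ioi (0:ℝ), (u / N k) •
      (Set.Iic π).indicator (hFn (m k) (N k)) ((u / N k) ^ 2 / 2)) =ᶠ[atTop]
      (fun k => (N k : ℂ) * ∫ t in (0:ℝ)..π, hFn (m k) (N k) t) := by
    filter_upwards [hN1] with k hk
    exact (cov _ _ hk).symm
  refine Tendsto.congr' hcong ?_
  apply tendsto_integral_filter_of_dominated_convergence (fun u => 10 * Real.exp (-(1/5) * u))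
  · refine Eventually.of_forall fun k => Measurable.aestronglyMeasurable ?_
    have := (hFn_meas (m k) (N k)).indicator (measurableSet_Iic (a := π))
    have h2 : Measurable fun u : ℝ => (u / N k) ^ 2 / 2 := by fun_prop
    have h3 : Measurable fun u : ℝ => u / N k := by fun_prop
    exact h3.smul (this.comp h2)
  · filter_upwards [hN1] with k hk
    filter_upwards [ae_restrict_mem measurableSet_Ioi] with u hu
    have hu0 : 0 < u := hu
    have hN0 : (0:ℝ) < N k := by exact_mod_cast hk
    have hx : 0 < u / N k := by positivity
    by_cases hle : (u / N k) ^ 2 / 2 ≤ π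
    · rw [Set.indicator_of_mem (show _ ∈ Set.Iic π from hle), norm_smul, Real.norm_of_nonneg hx.le]
      have := hFn_norm_le (m k) (N k) _ hx hle
      refine (mul_le_mul_of_nonneg_left this hx.le).trans (le_of_eq ?_)
      rw [← Real.exp_nat_mul, show (N k : ℝ) * -(u / N k / 5) = -(1/5) * u by field_simp]
      field_simp
    · rw [Set.indicator_of_notMem (show _ ∉ Set.Iic π from hle), smul_zero, norm_zero]
      positivity
  · exact (exp_neg_integrableOn_Ioi 0 (b := 1/5) (by norm_num)).const_mul 10
  · filter_upwards [ae_restrict_mem measurableSet_Ioi] with u hu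
    have hu0 : 0 < u := hu
    have hxN : Tendsto (fun n : ℕ => u / (n:ℝ)) atTop (nhdsWithin 0 (Set.Ioi 0)) := by
      apply tendsto_nhdsWithin_of_tendsto_nhds_of_eventually_within
      · exact tendsto_const_div_atTop_nhds_zero_nat u
      · filter_upwards [eventually_ge_atTop 1] with n hn
        have : (0:ℝ) < n := by exact_mod_cast hn
        show 0 < u / n
        positivity
    have hx := hxN.comp hN
    have hψ : Tendsto (fun n : ℕ => psiFn ((u / n) ^ 2 / 2) ^ n) atTop
        (nhds (Complex.exp (-(1 - I) * u))) := by
      have := Complex.tendsto_one_add_pow_exp_of_tendsto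
        (g := fun n : ℕ => psiFn ((u / n) ^ 2 / 2) - 1) (t := -(1 - I) * u) (by
          have h1 := (psi_lim.comp hxN).mul_const (u:ℂ)
          refine h1.congr' ?_
          filter_upwards [eventually_ge_atTop 1] with n hn
          have h3 : (n:ℂ) ≠ 0 := by exact_mod_cast (by omega : n ≠ 0)
          have h4 : (u:ℂ) ≠ 0 := by exact_mod_cast hu0.ne'
          simp only [Function.comp]
          push_cast
          field_simp)
      simpa using this
    have hψk := hψ.comp hN
    have hφk := (Complex.continuous_ofReal.tendsto _).comp (phi_lim.comp hx)
    have hek : Tendsto (fun k => Complex.exp (I * ((u ^ 2 / 2 * (m k / (N k : ℝ) ^ 2) : ℝ) : ℂ))) atTop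
        (nhds (Complex.exp (I * ((u ^ 2 / 2 * lam : ℝ) : ℂ)))) := by
      have hc : Continuous fun y : ℝ => Complex.exp (I * ((u ^ 2 / 2 * y : ℝ) : ℂ)) := by fun_prop
      exact (hc.tendsto lam).comp hm
    have hmain := (hφk.mul hek).mul hψk
    have hlim : ((1:ℝ):ℂ) * Complex.exp (I * ((u ^ 2 / 2 * lam : ℝ) : ℂ)) * Complex.exp (-(1 - I) * u) =
        Complex.exp (Complex.I * (lam / 2) * (u:ℂ) ^ 2 - (1 - Complex.I) * u) := by
      rw [Complex.ofReal_one, one_mul, ← Complex.exp_add]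
      congr 1
      push_cast
      ring
    rw [hlim] at hmain
    refine hmain.congr' ?_
    have hsmall : ∀ᶠ k in atTop, (u / (N k : ℝ)) ^ 2 / 2 ≤ π := by
      have hc : Continuous fun x : ℝ => x ^ 2 / 2 := by fun_prop
      have h1 := (hc.tendsto 0).comp (tendsto_nhds_of_tendsto_nhdsWithin hx)
      have := h1.eventually (ge_mem_nhds (show (0:ℝ) ^ 2 / 2 < π by simpa using Real.pi_pos))
      exact this
    filter_upwards [hsmall, hN1] with k hk hk1
    rw [Set.indicator_of_mem (show _ ∈ Set.Iic π from hk), hFn, Complex.real_smul]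
    have e : Complex.I * (((u / (N k : ℝ)) ^ 2 / 2 : ℝ) : ℂ) * (m k : ℂ) =
        I * ((u ^ 2 / 2 * (m k / (N k : ℝ) ^ 2) : ℝ) : ℂ) := by
      push_cast; ring
    rw [e]
    simp only [Function.comp]
    push_cast
    ring

/-- Along any sequence `(y₁(k), y₂(k))` with `|y₂| → ∞` and `y₁/y₂² → λ`, the
renormalized Fourier integral of the Green function,
`|y₂| ∫ e^{it(y₁-z)} ψ(t)^{|y₂|}/(1-φ(t)) dt`, converges to a nonzero constant. -/
theorem renormalized_green_tendsto_vertical (z : ℤ) (lam : ℝ)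
    (y₁ y₂ : ℕ → ℤ)
    (h₂ : Tendsto (fun k => |y₂ k|) atTop atTop)
    (hratio : Tendsto (fun k => (y₁ k : ℝ) / (y₂ k : ℝ) ^ 2) atTop (nhds lam)) :
    ∃ C : ℂ, C ≠ 0 ∧
      Tendsto (fun k =>
          ((|y₂ k| : ℤ) : ℂ) * ∫ t in (-Real.pi)..Real.pi,
            Complex.exp (Complex.I * t * ((y₁ k : ℂ) - (z : ℂ))) *
              psiFn t ^ (y₂ k).natAbs / (1 - (phiFn t : ℂ)))
        atTop (nhds C) := by
  set L : ℂ := ∫ v in Set.Ioi (0:ℝ),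
    Complex.exp (Complex.I * (lam / 2) * (v:ℂ) ^ 2 - (1 - Complex.I) * v) with hL
  have hpos : 0 < L.re := re_L_pos lam
  have hN : Tendsto (fun k => (y₂ k).natAbs) atTop atTop := by
    rw [← tendsto_natCast_atTop_iff (R := ℤ)]
    simpa using h₂
  have hsq : ∀ k, (((y₂ k).natAbs : ℕ) : ℝ) ^ 2 = (y₂ k : ℝ) ^ 2 := by
    intro k
    rw [Nat.cast_natAbs, Int.cast_abs, sq_abs]
  have hm : Tendsto (fun k => ((y₁ k : ℝ) - (z : ℝ)) / (((y₂ k).natAbs : ℕ) : ℝ) ^ 2) atTop (nhds lam) := by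
    have h1 : Tendsto (fun k => (((y₂ k).natAbs : ℕ) : ℝ) ^ 2) atTop atTop :=
      (tendsto_pow_atTop two_ne_zero).comp (tendsto_natCast_atTop_atTop.comp hN)
    have h3 : Tendsto (fun k => (z : ℝ) / (((y₂ k).natAbs : ℕ) : ℝ) ^ 2) atTop (nhds 0) :=
      h1.const_div_atTop _
    have h4 := hratio.sub h3
    rw [sub_zero] at h4
    refine h4.congr fun k => ?_
    rw [hsq, sub_div]
  have hh := half_lim lam (fun k => (y₁ k : ℝ) - (z : ℝ)) (fun k => (y₂ k).natAbs) hN hm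
  have hconj := (Complex.continuous_conj.tendsto L).comp hh
  refine ⟨L + (starRingEnd ℂ) L, ?_, ?_⟩
  · rw [Complex.add_conj]
    have : (2:ℝ) * L.re ≠ 0 := by positivity
    exact_mod_cast this
  · refine (hh.add hconj).congr fun k => ?_
    have e : ∫ t in (-Real.pi)..Real.pi,
            Complex.exp (Complex.I * t * ((y₁ k : ℂ) - (z : ℂ))) *
              psiFn t ^ (y₂ k).natAbs / (1 - (phiFn t : ℂ)) =
        ∫ t in (-Real.pi)..Real.pi, hFn ((y₁ k : ℝ) - (z : ℝ)) (y₂ k).natAbs t := by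
      simp only [hFn]
      push_cast
      rfl
    rw [e, full_eq]
    have e2 : ((|y₂ k| : ℤ) : ℂ) = (((y₂ k).natAbs : ℕ) : ℂ) := by
      rw [Nat.cast_natAbs]
    rw [e2]
    simp only [Function.comp, map_mul, Complex.conj_natCast]
    ring
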